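/- arXiv:2003.01032 — 2 statements merged into one kernel-verified Lean document; each statement's English description precedes it below -/
import Mathlib

section
/- Let d ≥ 1 and ε ≥ 0, and let (M_a)_{a∈[d]} be a d-outcome POVM on ℂ^d such that ‖M_a‖ ≥ 1 − ε for every a ∈ [d]. Then for every a ∈ [d], Re tr(M_a²) ≤ 1 + d²ε². (Auxiliary bound used in the proof of Theorem 1: writing M_a = λ_a|φ_a⟩⟨φ_a| + Rest_a, one has ∑_a tr(Rest_a) ≤ dε so that tr(M_a²) = λ_a² + tr(Rest_a²) ≤ 1 + (dε)².) -/
open Matrix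
open scoped ComplexOrder

/-- Operator (spectral) norm of a complex matrix, as the norm of the induced
map between Euclidean spaces. -/
noncomputable def opNorm {m n : ℕ} (A : Matrix (Fin m) (Fin n) ℂ) : ℝ :=
  ‖LinearMap.toContinuousLinearMap (Matrix.toEuclideanLin A)‖

open scoped Matrix.Norms.L2Operator in
/-- The operator norm of a positive semidefinite matrix is bounded by one of its eigenvalues. -/
lemma exists_opNorm_le_eigenvalues {d : ℕ} [NeZero d] {A : Matrix (Fin d) (Fin d) ℂ}
    (hA : A.PosSemidef) : ∃ i, opNorm A ≤ hA.isHermitian.eigenvalues i := by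
  obtain ⟨i, hi⟩ := Finite.exists_max hA.isHermitian.eigenvalues
  refine ⟨i, ?_⟩
  have hnorm : opNorm A = ‖A‖ := rfl
  rw [hnorm]
  conv_lhs => rw [hA.isHermitian.spectral_theorem, Unitary.conjStarAlgAut_apply, ← Unitary.coe_star,
    CStarRing.norm_mul_coe_unitary, CStarRing.norm_coe_unitary_mul, l2_opNorm_diagonal]
  refine (pi_norm_le_iff_of_nonneg (hA.eigenvalues_nonneg i)).2 fun j ↦ ?_
  simpa [abs_of_nonneg (hA.eigenvalues_nonneg j)] using hi j

/-- The trace of the square of a Hermitian matrix is the sum of its squared eigenvalues. -/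
lemma Matrix.IsHermitian.re_trace_mul_self {n : Type*} [Fintype n] [DecidableEq n]
    {A : Matrix n n ℂ} (hA : A.IsHermitian) :
    (A * A).trace.re = ∑ i, hA.eigenvalues i ^ 2 := by
  conv_lhs => rw [hA.spectral_theorem, ← map_mul, Unitary.conjStarAlgAut_apply, trace_mul_cycle,
    Unitary.coe_star_mul_self, one_mul, diagonal_mul_diagonal, trace_diagonal]
  simp [pow_two]

lemma Matrix.IsHermitian.re_trace_eq_sum_eigenvalues {n : Type*} [Fintype n] [DecidableEq n]
    {A : Matrix n n ℂ} (hA : A.IsHermitian) :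
    A.trace.re = ∑ i, hA.eigenvalues i := by
  simp [hA.trace_eq_sum_eigenvalues]

lemma Matrix.IsHermitian.eigenvalues_le_one {n : Type*} [Fintype n] [DecidableEq n]
    {A : Matrix n n ℂ} (hA : A.IsHermitian) (h : (1 - A).PosSemidef) (i : n) :
    hA.eigenvalues i ≤ 1 := by
  have key := h.re_dotProduct_nonneg (hA.eigenvectorBasis i : n → ℂ)
  have hunit : star (hA.eigenvectorBasis i : n → ℂ) ⬝ᵥ (hA.eigenvectorBasis i : n → ℂ) = 1 := by
    rw [dotProduct_comm, ← EuclideanSpace.inner_eq_star_dotProduct, inner_self_eq_norm_sq_to_K,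
      hA.eigenvectorBasis.orthonormal.1 i]
    simp
  rw [sub_mulVec, one_mulVec, dotProduct_sub, hunit, map_sub, ← hA.eigenvalues_eq] at key
  simpa using key

lemma opNorm_le_re_trace {d : ℕ} [NeZero d] {A : Matrix (Fin d) (Fin d) ℂ}
    (hA : A.PosSemidef) : opNorm A ≤ A.trace.re := by
  obtain ⟨i, hi⟩ := exists_opNorm_le_eigenvalues hA
  rw [hA.isHermitian.re_trace_eq_sum_eigenvalues]
  exact hi.trans (Finset.single_le_sum (fun j _ ↦ hA.eigenvalues_nonneg j) (Finset.mem_univ i))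

/-- Auxiliary bound used in the proof of Theorem 1: a POVM whose effects all have
operator norm at least `1 - ε` satisfies `Re tr(M_a²) ≤ 1 + d²ε²`. -/
theorem trace_sq_le_of_near_projective (d : ℕ) (hd : 1 ≤ d) (ε : ℝ) (hε : 0 ≤ ε)
    (M : Fin d → Matrix (Fin d) (Fin d) ℂ)
    (hMpos : ∀ a, (M a).PosSemidef)
    (hMsum : ∑ a, M a = 1)
    (hMnorm : ∀ a, 1 - ε ≤ opNorm (M a)) :
    ∀ a, ((M a * M a).trace).re ≤ 1 + (d : ℝ)^2 * ε^2 := by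
  intro a
  have : NeZero d := ⟨by omega⟩
  have hA := (hMpos a).isHermitian
  have htrace : ∑ b, (M b).trace.re = d := by
    rw [← Complex.re_sum, ← trace_sum, hMsum]
    simp
  have hothers : ((d : ℝ) - 1) * (1 - ε) ≤ ∑ b ∈ Finset.univ.erase a, (M b).trace.re := by
    have := Finset.card_nsmul_le_sum (Finset.univ.erase a) (fun b ↦ (M b).trace.re) (1 - ε)
      fun b _ ↦ (hMnorm b).trans (opNorm_le_re_trace (hMpos b))
    simpa [Finset.card_erase_of_mem, Nat.cast_sub hd] using this
  rw [← Finset.add_sum_erase _ _ (Finset.mem_univ a), hA.re_trace_eq_sum_eigenvalues] at htrace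
  have hcompl : (1 - M a).PosSemidef := by
    rw [← hMsum, ← Finset.add_sum_erase _ _ (Finset.mem_univ a), add_sub_cancel_left]
    exact posSemidef_sum _ fun b _ ↦ hMpos b
  obtain ⟨i, hi⟩ := exists_opNorm_le_eigenvalues (hMpos a)
  have hlow := (hMnorm a).trans hi
  have hone := hA.eigenvalues_le_one hcompl i
  have hnonneg := (hMpos a).eigenvalues_nonneg
  rw [← Finset.add_sum_erase _ _ (Finset.mem_univ i)] at htrace
  rw [hA.re_trace_mul_self, ← Finset.add_sum_erase _ _ (Finset.mem_univ i)]
  have hrest : ∑ j ∈ Finset.univ.erase i, hA.eigenvalues j ≤ d * ε := by linarith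
  have hrest_nonneg : 0 ≤ ∑ j ∈ Finset.univ.erase i, hA.eigenvalues j :=
    Finset.sum_nonneg fun j _ ↦ hnonneg j
  have hsq := Finset.sum_sq_le_sq_sum_of_nonneg (s := Finset.univ.erase i)
    (f := hA.eigenvalues) fun j _ ↦ hnonneg j
  have htop : hA.eigenvalues i ^ 2 ≤ 1 := pow_le_one₀ (hnonneg i) hone
  have hrest_sq := pow_le_pow_left₀ hrest_nonneg hrest 2
  rw [mul_pow] at hrest_sq
  linarith
end

section
/- In the prepare-and-measure scenario on ℂ² with n settings: suppose the target pure qubit states ρ^x_a (a∈{1,2}, x∈[n]) are such that for each x the pair (ρ^x_1, ρ^x_2) consists of rank-one orthogonal projections with ρ^x_1 + ρ^x_2 = I, and suppose the experimental density matrices ρ̃^x_a on ℂ² and experimental 2-outcome POVMs (M̃^y_1, M̃^y_2) on ℂ² satisfy |Re tr(ρ̃^x_a M̃^y_b) − Re tr(ρ^x_a ρ^y_b)| ≤ ε for all a,b∈{1,2}, x,y∈[n], with 0 ≤ ε ≤ 1/3. Let S ⊆ [n] with |S| = k ∈ {2,3}, and let Γ and Γ̃ be the Bloch Gram matrices of {ρ^x_1}_{x∈S}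 and {ρ̃^x_1}_{x∈S}, i.e. Γ_{x,x'} = 2 Re tr(ρ^x_1 ρ^{x'}_1) − 1 and Γ̃_{x,x'} = 2 Re tr(ρ̃^x_1 ρ̃^{x'}_1) − 1. Then ‖Γ̃ − Γ‖ ≤ O_k(ε), where ‖·‖ is the operator norm and O_k(ε) = 2((k−1)√ε + (k+1)ε). (Lemma 2, operator-norm bound on the perturbation of the Gram matrix.) -/
open Matrix
open scoped ComplexOrder

/-- Operator (spectral) norm of a real matrix, as the norm of the induced
map between Euclidean spaces. -/
noncomputable def opNormR {m n : ℕ} (A : Matrix (Fin m) (Fin n) ℝ) : ℝ :=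
  ‖LinearMap.toContinuousLinearMap (Matrix.toEuclideanLin A)‖

/-- A density matrix: positive semidefinite with trace one. -/
def IsDensityMatrix {d : ℕ} (ρ : Matrix (Fin d) (Fin d) ℂ) : Prop :=
  ρ.PosSemidef ∧ ρ.trace = 1

/-- A pure state: a rank-one orthogonal projection (Hermitian, idempotent, trace one). -/
def IsPureState {d : ℕ} (ρ : Matrix (Fin d) (Fin d) ℂ) : Prop :=
  ρ.IsHermitian ∧ ρ * ρ = ρ ∧ ρ.trace = 1

/-- Schur test: a symmetric real matrix is bounded in operator norm by its absolute row sums. -/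
theorem opNormR_le_of_row_sum_le {m : ℕ} (A : Matrix (Fin m) (Fin m) ℝ) (hA : A.IsSymm)
    {C : ℝ} (hC : 0 ≤ C) (hrow : ∀ i, ∑ j, |A i j| ≤ C) : opNormR A ≤ C := by
  refine ContinuousLinearMap.opNorm_le_bound _ hC fun x => ?_
  refine abs_le_of_sq_le_sq' ?_ (by positivity) |>.2
  have hcol : ∀ j, ∑ i, |A i j| ≤ C := fun j => by
    simpa only [hA.apply] using hrow j
  have hcs : ∀ i, (∑ j, A i j * x j) ^ 2 ≤ C * ∑ j, |A i j| * x j ^ 2 := fun i => by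
    calc (∑ j, A i j * x j) ^ 2 ≤ (∑ j, |A i j|) * ∑ j, |A i j| * x j ^ 2 := by
          refine Finset.sum_sq_le_sum_mul_sum_of_sq_le_mul _ (fun _ _ => by positivity)
            (fun _ _ => by positivity) fun j _ => ?_
          rw [mul_pow, ← sq_abs (A i j), sq, mul_assoc]
      _ ≤ C * ∑ j, |A i j| * x j ^ 2 :=
          mul_le_mul_of_nonneg_right (hrow i) (Finset.sum_nonneg fun _ _ => by positivity)
  rw [mul_pow, EuclideanSpace.real_norm_sq_eq, EuclideanSpace.real_norm_sq_eq]
  calc ∑ i, ((LinearMap.toContinuousLinearMap (Matrix.toEuclideanLin A)) x) i ^ 2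
      = ∑ i, (∑ j, A i j * x j) ^ 2 := rfl
    _ ≤ ∑ i, C * ∑ j, |A i j| * x j ^ 2 := Finset.sum_le_sum fun i _ => hcs i
    _ = C * ∑ j, (∑ i, |A i j|) * x j ^ 2 := by
        rw [← Finset.mul_sum, Finset.sum_comm]
        simp only [Finset.sum_mul]
    _ ≤ C * ∑ j, C * x j ^ 2 := by
        gcongr with j
        exact hcol j
    _ = C ^ 2 * ∑ j, x j ^ 2 := by
        rw [← Finset.mul_sum]
        ring

/-- The Bloch vector of a Hermitian `2 × 2` matrix, scaled by its trace. -/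
noncomputable def blochVector (A : Matrix (Fin 2) (Fin 2) ℂ) : EuclideanSpace ℝ (Fin 3) :=
  !₂[2 * (A 0 1).re, 2 * (A 0 1).im, (A 0 0).re - (A 1 1).re]

theorem inner_blochVector (A B : Matrix (Fin 2) (Fin 2) ℂ) :
    inner ℝ (blochVector A) (blochVector B) =
      4 * (A 0 1).re * (B 0 1).re + 4 * (A 0 1).im * (B 0 1).im
        + ((A 0 0).re - (A 1 1).re) * ((B 0 0).re - (B 1 1).re) := by
  simp [blochVector, PiLp.inner_apply, Fin.sum_univ_three]
  ring

theorem two_mul_trace_mul_re {A B : Matrix (Fin 2) (Fin 2) ℂ}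
    (hA : A.IsHermitian) (hB : B.IsHermitian) :
    2 * (A * B).trace.re =
      A.trace.re * B.trace.re + inner ℝ (blochVector A) (blochVector B) := by
  have hA0 := congrArg Complex.im (hA.apply 0 0)
  have hA1 := congrArg Complex.im (hA.apply 1 1)
  rw [inner_blochVector]
  simp only [Matrix.trace_fin_two, Matrix.mul_apply, Fin.sum_univ_two, Complex.add_re,
    Complex.mul_re, ← hA.apply 1 0, ← hB.apply 1 0, Complex.star_def, Complex.conj_re,
    Complex.conj_im] at hA0 hA1 ⊢
  have h0 : (A 0 0).im = 0 := by linarith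
  have h1 : (A 1 1).im = 0 := by linarith
  rw [h0, h1]
  ring

theorem norm_blochVector_le_trace {A : Matrix (Fin 2) (Fin 2) ℂ} (hA : A.PosSemidef) :
    ‖blochVector A‖ ≤ A.trace.re := by
  have h0 := Complex.nonneg_iff.1 (hA.diag_nonneg (i := 0))
  have h1 := Complex.nonneg_iff.1 (hA.diag_nonneg (i := 1))
  have hdet := (Complex.nonneg_iff.1 hA.det_nonneg).1
  rw [Matrix.det_fin_two, ← hA.isHermitian.apply 1 0] at hdet
  simp only [Complex.sub_re, Complex.mul_re, Complex.star_def, Complex.conj_re, Complex.conj_im,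
    ← h0.2, ← h1.2] at hdet
  rw [Matrix.trace_fin_two, Complex.add_re]
  refine abs_le_of_sq_le_sq' ?_ (add_nonneg h0.1 h1.1) |>.2
  rw [← real_inner_self_eq_norm_sq, inner_blochVector]
  linarith

/-- If a two-outcome measurement with bias `δ` and Bloch vector `m` nearly discriminates the Bloch
vectors `s` and `t`, then `δ` is small and `m` is close to `s`. -/
theorem discrimination_bias_and_dist {E : Type*} [NormedAddCommGroup E] [InnerProductSpace ℝ E]
    {s t m : E} {δ ε : ℝ} (hs : ‖s‖ ≤ 1) (ht : ‖t‖ ≤ 1) (hm : ‖m‖ ≤ 1 - |δ|)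
    (h1 : 1 - 2 * ε ≤ δ + inner ℝ s m) (h2 : δ + inner ℝ t m ≤ -(1 - 2 * ε)) :
    |δ| ≤ ε ∧ ‖s - m‖ ^ 2 ≤ 4 * ε + ε ^ 2 - (1 - ‖s‖ ^ 2) := by
  have hsm : inner ℝ s m ≤ 1 - |δ| := (real_inner_le_norm s m).trans <|
    (mul_le_of_le_one_left (norm_nonneg m) hs).trans hm
  have htm : -(inner ℝ t m) ≤ 1 - |δ| :=
    (neg_le_abs _).trans <| (abs_real_inner_le_norm t m).trans <|
    (mul_le_of_le_one_left (norm_nonneg m) ht).trans hm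
  have hδ : |δ| ≤ ε := by
    rcases abs_cases δ with ⟨h, _⟩ | ⟨h, _⟩ <;> rw [h] at hsm htm ⊢ <;> linarith
  refine ⟨hδ, ?_⟩
  rw [norm_sub_sq_real]
  have hm2 : ‖m‖ ^ 2 ≤ (1 - |δ|) ^ 2 := by gcongr
  have hδ2 : |δ| ^ 2 ≤ ε ^ 2 := by gcongr
  nlinarith [le_abs_self δ]

theorem row_sum_scalar_bound {k ε a y : ℝ} (hk : k = 2 ∨ k = 3) (hε0 : 0 ≤ ε) (hε : ε ≤ 1 / 3)
    (ha : 0 ≤ a) (hy : 0 ≤ y) (hay : y ^ 2 ≤ 4 * ε + ε ^ 2 - a) :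
    a + (k - 1) * (3 * ε + y) ≤ 2 * ((k - 1) * √ε + (k + 1) * ε) := by
  obtain ⟨q, hq⟩ : ∃ q, q = √ε := ⟨_, rfl⟩
  have hq0 : 0 ≤ q := hq ▸ Real.sqrt_nonneg ε
  have hqε : ε = q ^ 2 := by rw [hq, Real.sq_sqrt hε0]
  rw [← hq]
  subst hqε
  have hq1 : q ≤ 3 / 5 := by nlinarith
  have hy2 : y ≤ 2 * q + q ^ 3 / 4 := by
    refine abs_le_of_sq_le_sq' ?_ (by positivity) |>.2
    nlinarith [sq_nonneg (q ^ 3)]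
  rcases hk with rfl | rfl
  · rcases le_total q (1 / 6) with h | h
    · nlinarith [mul_nonneg hq0 (sub_nonneg.2 h),
        mul_nonneg (mul_nonneg hq0 hq0) (sub_nonneg.2 h),
        mul_nonneg (sub_nonneg.2 hy2) (sub_nonneg.2 h), mul_nonneg (sub_nonneg.2 hy2) hy]
    · have : (q ^ 2 + 1 / 2) ^ 2 ≤ 2 * q := by
        nlinarith [mul_nonneg (sub_nonneg.2 h) (sub_nonneg.2 hq1), mul_nonneg hq0 hq0]
      nlinarith [sq_nonneg (y - 1 / 2)]
  · rcases le_total q (9 / 20) with h | h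
    · have hz : 2 * q + q ^ 3 / 4 ≤ 1 := by nlinarith [mul_nonneg hq0 hq0]
      nlinarith [mul_nonneg (sub_nonneg.2 hy2) (sub_nonneg.2 hz),
        mul_nonneg (mul_nonneg hq0 hq0) (sub_nonneg.2 h)]
    · have : (1 + q ^ 2) ^ 2 ≤ 4 * q := by
        nlinarith [mul_nonneg (sub_nonneg.2 h) (sub_nonneg.2 hq1), mul_nonneg hq0 hq0]
      nlinarith [sq_nonneg (y - 1)]

/-- Lemma 2, operator-norm bound on the perturbation of the Bloch Gram matrix. -/
theorem gram_matrix_opNorm_bound (n k : ℕ) (hk : k = 2 ∨ k = 3)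
    (ε : ℝ) (hε0 : 0 ≤ ε) (hε : ε ≤ 1/3)
    (ρ ρt Mt : Fin n → Fin 2 → Matrix (Fin 2) (Fin 2) ℂ)
    (hρ : ∀ x a, IsPureState (ρ x a))
    (hρsum : ∀ x, ρ x 0 + ρ x 1 = 1)
    (hρt : ∀ x a, IsDensityMatrix (ρt x a))
    (hMt : ∀ y b, (Mt y b).PosSemidef)
    (hMtsum : ∀ y, Mt y 0 + Mt y 1 = 1)
    (hstat : ∀ x y a b,
      |((ρt x a * Mt y b).trace).re - ((ρ x a * ρ y b).trace).re| ≤ ε)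
    (S : Fin k ↪ Fin n)
    (Γ Γt : Matrix (Fin k) (Fin k) ℝ)
    (hΓ : ∀ i j, Γ i j = 2 * ((ρ (S i) 0 * ρ (S j) 0).trace).re - 1)
    (hΓt : ∀ i j, Γt i j = 2 * ((ρt (S i) 0 * ρt (S j) 0).trace).re - 1) :
    opNormR (Γt - Γ) ≤ 2 * (((k : ℝ) - 1) * Real.sqrt ε + ((k : ℝ) + 1) * ε) := by
  have hkR : (k : ℝ) = 2 ∨ (k : ℝ) = 3 := by exact_mod_cast hk
  have htr : ∀ x a, (ρ x a).trace.re = 1 := fun x a => by rw [(hρ x a).2.2, Complex.one_re]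
  have httr : ∀ x a, (ρt x a).trace.re = 1 := fun x a => by rw [(hρt x a).2, Complex.one_re]
  have hnorm : ∀ x a, ‖blochVector (ρt x a)‖ ≤ 1 := fun x a =>
    httr x a ▸ norm_blochVector_le_trace (hρt x a).1
  have hself : ∀ x, (ρ x 0 * ρ x 0).trace.re = 1 := fun x => by rw [(hρ x 0).2.1, htr]
  have hcross : ∀ x, (ρ x 1 * ρ x 0).trace.re = 0 := fun x => by
    rw [eq_sub_of_add_eq' (hρsum x), sub_mul, one_mul, (hρ x 0).2.1, sub_self]
    simp
  obtain ⟨δ, hδ⟩ : ∃ δ : Fin n → ℝ, ∀ y, δ y = (Mt y 0).trace.re - 1 := ⟨_, fun _ => rfl⟩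
  have hM : ∀ y, ‖blochVector (Mt y 0)‖ ≤ 1 - |δ y| := fun y => by
    have h0 := norm_blochVector_le_trace (hMt y 0)
    have h1 := norm_blochVector_le_trace (hMt y 1)
    rw [eq_sub_of_add_eq' (hMtsum y)] at h1
    have hneg : blochVector (1 - Mt y 0) = -blochVector (Mt y 0) := by
      ext i
      fin_cases i <;> simp [blochVector]
    rw [hneg, norm_neg, Matrix.trace_sub, Matrix.trace_one] at h1
    simp only [Fintype.card_fin, Nat.cast_ofNat, Complex.sub_re, Complex.re_ofNat] at h1
    rcases abs_cases (δ y) with ⟨h, _⟩ | ⟨h, _⟩ <;> rw [h, hδ] <;> linarith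
  have hstat' : ∀ x y a, |δ y + inner ℝ (blochVector (ρt x a)) (blochVector (Mt y 0))
      - (2 * (ρ x a * ρ y 0).trace.re - 1)| ≤ 2 * ε := fun x y a => by
    have h := two_mul_trace_mul_re (hρt x a).1.isHermitian (hMt y 0).isHermitian
    rw [httr, one_mul] at h
    have h' := abs_le.1 (hstat x y a 0)
    rw [hδ, abs_le]
    constructor <;> linarith
  have hkey : ∀ y, |δ y| ≤ ε ∧ ‖blochVector (ρt y 0) - blochVector (Mt y 0)‖ ^ 2
      ≤ 4 * ε + ε ^ 2 - (1 - ‖blochVector (ρt y 0)‖ ^ 2) := fun y => by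
    have h0 := abs_le.1 (hstat' y y 0)
    have h1 := abs_le.1 (hstat' y y 1)
    rw [hself] at h0
    rw [hcross] at h1
    exact discrimination_bias_and_dist (hnorm y 0) (hnorm y 1) (hM y)
      (by linarith) (by linarith)
  have hΓt' : ∀ i j, Γt i j =
      inner ℝ (blochVector (ρt (S i) 0)) (blochVector (ρt (S j) 0)) := fun i j => by
    rw [hΓt, two_mul_trace_mul_re (hρt _ _).1.isHermitian (hρt _ _).1.isHermitian, httr, httr]
    ring
  have hsymm : (Γt - Γ).IsSymm := by
    refine Matrix.IsSymm.ext fun i j => ?_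
    rw [Matrix.sub_apply, Matrix.sub_apply, hΓ, hΓ, hΓt, hΓt, Matrix.trace_mul_comm,
      Matrix.trace_mul_comm (ρ _ _)]
  have hoff : ∀ i j, |(Γt - Γ) i j| ≤
      3 * ε + ‖blochVector (ρt (S i) 0) - blochVector (Mt (S i) 0)‖ := fun i j => by
    rw [← hsymm.apply, Matrix.sub_apply, hΓt', hΓ]
    have hst := abs_le.1 (hstat' (S j) (S i) 0)
    have hd := abs_le.1 (hkey (S i)).1
    have hin : |inner ℝ (blochVector (ρt (S j) 0))
        (blochVector (ρt (S i) 0) - blochVector (Mt (S i) 0))| ≤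
        ‖blochVector (ρt (S i) 0) - blochVector (Mt (S i) 0)‖ :=
      (abs_real_inner_le_norm _ _).trans
        (mul_le_of_le_one_left (norm_nonneg _) (hnorm _ _))
    rw [inner_sub_right] at hin
    have hin' := abs_le.1 hin
    rw [abs_le]
    constructor <;> linarith
  have hdiag : ∀ i, |(Γt - Γ) i i| = 1 - ‖blochVector (ρt (S i) 0)‖ ^ 2 := fun i => by
    rw [Matrix.sub_apply, hΓt', hΓ, hself, real_inner_self_eq_norm_sq, abs_of_nonpos] <;>
      linarith [pow_le_one₀ (n := 2) (norm_nonneg _) (hnorm (S i) 0)]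
  refine opNormR_le_of_row_sum_le _ hsymm ?_ fun i => ?_
  · have : 0 ≤ (k : ℝ) - 1 := by rcases hkR with h | h <;> rw [h] <;> norm_num
    positivity
  · have hsum : ∑ j ∈ Finset.univ.erase i, |(Γt - Γ) i j| ≤ ((k : ℝ) - 1) *
        (3 * ε + ‖blochVector (ρt (S i) 0) - blochVector (Mt (S i) 0)‖) := by
      refine (Finset.sum_le_card_nsmul _ _ _ fun j _ => hoff i j).trans_eq ?_
      rw [Finset.card_erase_of_mem (Finset.mem_univ i), Finset.card_univ, Fintype.card_fin,
        nsmul_eq_mul, Nat.cast_sub (by omega), Nat.cast_one]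
    rw [← Finset.add_sum_erase _ _ (Finset.mem_univ i), hdiag]
    have ha : 0 ≤ 1 - ‖blochVector (ρt (S i) 0)‖ ^ 2 := hdiag i ▸ abs_nonneg _
    linarith [row_sum_scalar_bound hkR hε0 hε ha (norm_nonneg _) (hkey (S i)).2]
end
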